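/- arXiv:2101.03800 — 2 statements merged into one kernel-verified Lean document; each statement's English description precedes it below -/
import Mathlib

section
/- Let n ≥ 5 and let G be a graph on n vertices. Then G has exactly F(n+1) − 1 matching cuts if and only if G is isomorphic to the path graph P_n on n vertices. -/
namespace MatchingCutPaper

/-- The set of edges of `G` with one endpoint in `A` and the other endpoint outside `A`. -/
def cutEdges {V : Type} (G : SimpleGraph V) (A : Set V) : Set (Sym2 V) :=
  {e | e ∈ G.edgeSet ∧ ∃ u v : V, e = s(u, v) ∧ u ∈ A ∧ v ∉ A}

/-- `M` is a matching of `G`: a set of edges of `G`, no two of which share an endpoint. -/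
def IsMatchingSet {V : Type} (G : SimpleGraph V) (M : Set (Sym2 V)) : Prop :=
  M ⊆ G.edgeSet ∧ ∀ e ∈ M, ∀ f ∈ M, e ≠ f → ∀ v : V, ¬(v ∈ e ∧ v ∈ f)

/-- `M` is a matching cut of `G`: a matching of the form `E(A, B)` for a partition `{A, B}`
of the vertex set into two nonempty parts. -/
def IsMatchingCut {V : Type} (G : SimpleGraph V) (M : Set (Sym2 V)) : Prop :=
  IsMatchingSet G M ∧ ∃ A : Set V, A.Nonempty ∧ Aᶜ.Nonempty ∧ M = cutEdges G A

/-- A matching cut is minimal if no proper subset of it is a matching cut. -/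
def IsMinimalMatchingCut {V : Type} (G : SimpleGraph V) (M : Set (Sym2 V)) : Prop :=
  IsMatchingCut G M ∧ ∀ M' : Set (Sym2 V), M' ⊂ M → ¬ IsMatchingCut G M'

/-- A matching cut is maximal if no proper superset of it is a matching cut. -/
def IsMaximalMatchingCut {V : Type} (G : SimpleGraph V) (M : Set (Sym2 V)) : Prop :=
  IsMatchingCut G M ∧ ∀ M' : Set (Sym2 V), M ⊂ M' → ¬ IsMatchingCut G M'

theorem exists_subsingleton_neighbors_of_isAcyclic {W : Type} [Finite W] [Nonempty W]
    {G : SimpleGraph W} (hG : G.IsAcyclic) :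
    ∃ v, ∀ a b, G.Adj v a → G.Adj v b → a = b := by
  obtain ⟨u, v, p, hp, hmax⟩ :=
    SimpleGraph.Walk.exists_isPath_forall_isPath_length_le_length G
  have key : ∀ w, G.Adj u w → w = p.snd := by
    intro w hadj
    apply hG.eq_snd_of_adj_start hp hadj
    have : ¬(p.cons hadj.symm).IsPath := by grind [SimpleGraph.Walk.length_cons]
    grind [hp.cons]
  exact ⟨u, fun a b ha hb ↦ (key a ha).trans (key b hb).symm⟩

theorem exists_mem_subsingleton_neighbors_of_isAcyclic {V : Type} {F : SimpleGraph V}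
    (hF : F.IsAcyclic) {S : Finset V} (hS : S.Nonempty) :
    ∃ v ∈ S, ∀ a ∈ S, ∀ b ∈ S, F.Adj v a → F.Adj v b → a = b := by
  have : Nonempty (S : Set V) := hS.to_subtype
  obtain ⟨⟨v, hv⟩, h⟩ := exists_subsingleton_neighbors_of_isAcyclic (hF.induce (S : Set V))
  refine ⟨v, hv, fun a ha b hb hva hvb ↦ ?_⟩
  simpa using h ⟨a, ha⟩ ⟨b, hb⟩ hva hvb

/-- The matchings of `G` all of whose edges have both endpoints in `S`. -/
def matchingsIn {V : Type} (G : SimpleGraph V) (S : Finset V) : Set (Set (Sym2 V)) :=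
  {M | IsMatchingSet G M ∧ ∀ e ∈ M, ∀ x ∈ e, x ∈ S}

theorem IsMatchingSet.mono {V : Type} {G : SimpleGraph V} {M N : Set (Sym2 V)}
    (hM : IsMatchingSet G M) (h : N ⊆ M) : IsMatchingSet G N :=
  ⟨h.trans hM.1, fun e he f hf ↦ hM.2 e (h he) f (h hf)⟩

theorem isMatchingSet_empty {V : Type} (G : SimpleGraph V) : IsMatchingSet G ∅ :=
  ⟨Set.empty_subset _, by simp⟩

section

variable {V : Type} {F : SimpleGraph V}

theorem matchingsIn_empty : matchingsIn F ∅ = {∅} := by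
  ext M
  simp only [Set.mem_singleton_iff]
  constructor
  · rintro ⟨-, h⟩
    rw [Set.eq_empty_iff_forall_notMem]
    intro e he
    induction e with
    | _ x y => simpa using h _ he x (by simp)
  · rintro rfl
    exact ⟨isMatchingSet_empty F, by simp⟩

theorem matchingsIn_erase_of_isolated [DecidableEq V] {S : Finset V} {v : V}
    (hv : ∀ w ∈ S, ¬ F.Adj v w) : matchingsIn F S = matchingsIn F (S.erase v) := by
  ext M
  constructor
  · rintro ⟨hM, h⟩
    refine ⟨hM, fun e he x hx ↦ Finset.mem_erase.2 ⟨?_, h e he x hx⟩⟩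
    rintro rfl
    obtain ⟨y, rfl⟩ := hx
    exact hv y (h _ he y (by simp)) (hM.1 he)
  · rintro ⟨hM, h⟩
    exact ⟨hM, fun e he x hx ↦ Finset.mem_of_mem_erase (h e he x hx)⟩

theorem reachable_of_isChain {G H : SimpleGraph V} {l : List V} (hl : l.IsChain G.Adj)
    (h : ∀ x ∈ l, ∀ y ∈ l, G.Adj x y → H.Adj x y) {a b : V} (ha : a ∈ l) (hb : b ∈ l) :
    H.Reachable a b := by
  induction l generalizing a b with
  | nil => simp at ha
  | cons c l ih =>
    rw [List.isChain_cons] at hl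
    have ih' := fun {a b : V} (ha : a ∈ l) (hb : b ∈ l) ↦ ih hl.2
      (fun x hx y hy ↦ h x (List.mem_cons_of_mem _ hx) y (List.mem_cons_of_mem _ hy)) ha hb
    have key : ∀ a ∈ l, H.Reachable c a := by
      intro a ha
      obtain ⟨d, l', rfl⟩ := List.exists_cons_of_ne_nil (List.ne_nil_of_mem ha)
      have hcd : G.Adj c d := hl.1 d (by simp)
      exact (h c (by simp) d (by simp) hcd).reachable.trans (ih' (by simp) ha)
    rcases List.mem_cons.1 ha with rfl | ha' <;> rcases List.mem_cons.1 hb with rfl | hb'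
    · rfl
    · exact key b hb'
    · exact (key a ha').symm
    · exact ih' ha' hb'

/-- Two distinct neighbours of a vertex `u` of a forest are not joined by a path avoiding `u`. -/
theorem false_of_isChain_of_adj (hF : F.IsAcyclic) {l : List V} (hl : l.IsChain F.Adj)
    {a b u : V} (ha : a ∈ l) (hb : b ∈ l) (hu : u ∉ l) (hab : a ≠ b) (hau : F.Adj a u)
    (hub : F.Adj u b) : False := by
  have hbr := SimpleGraph.isAcyclic_iff_forall_adj_isBridge.1 hF hau
  rw [SimpleGraph.isBridge_iff] at hbr
  apply hbr
  have h₁ : (F.deleteEdges {s(a, u)}).Reachable a b := by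
    refine reachable_of_isChain hl (fun x hx y hy hxy ↦ ?_) ha hb
    rw [SimpleGraph.deleteEdges_adj]
    refine ⟨hxy, ?_⟩
    rintro h
    have : u ∈ s(x, y) := h ▸ (by simp)
    rcases Sym2.mem_iff.1 this with rfl | rfl <;> contradiction
  refine h₁.trans (SimpleGraph.Adj.reachable ?_)
  rw [SimpleGraph.deleteEdges_adj]
  refine ⟨hub.symm, ?_⟩
  intro h
  simp [hab.symm, hub.ne'] at h

variable [Finite V] [DecidableEq V]

/-- Deleting a vertex `v` whose only neighbour is `u` splits the matchings according to whether
they use the edge `uv`. -/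
theorem ncard_matchingsIn_leaf {S : Finset V} {v u : V} (hvS : v ∈ S) (huS : u ∈ S)
    (hvu : F.Adj v u) (hv : ∀ w ∈ S, F.Adj v w → w = u) :
    (matchingsIn F S).ncard =
      (matchingsIn F (S.erase v)).ncard + (matchingsIn F ((S.erase v).erase u)).ncard := by
  have hnot : ∀ M ∈ matchingsIn F ((S.erase v).erase u), s(v, u) ∉ M := fun M hM h ↦ by
    simpa using hM.2 _ h u (by simp)
  have hinj : Set.InjOn (insert s(v, u)) (matchingsIn F ((S.erase v).erase u)) := by
    intro M hM N hN h
    have := congrArg (· \ {s(v, u)}) h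
    simpa [Set.insert_sdiff_of_mem, Set.sdiff_singleton_eq_self (hnot M hM),
      Set.sdiff_singleton_eq_self (hnot N hN)] using this
  have hunion : matchingsIn F S = matchingsIn F (S.erase v) ∪
      insert s(v, u) '' matchingsIn F ((S.erase v).erase u) := by
    ext M
    constructor
    · rintro ⟨hM, h⟩
      by_cases hmem : s(v, u) ∈ M
      · right
        refine ⟨M \ {s(v, u)}, ⟨hM.mono Set.sdiff_subset, ?_⟩, by simp [hmem]⟩
        rintro e ⟨he, hne⟩ x hx
        have hd := hM.2 e he _ hmem hne x
        simp only [Finset.mem_erase]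
        refine ⟨?_, ?_, h e he x hx⟩ <;> rintro rfl <;> simp [hx] at hd
      · left
        refine ⟨hM, fun e he x hx ↦ Finset.mem_erase.2 ⟨?_, h e he x hx⟩⟩
        rintro rfl
        obtain ⟨y, rfl⟩ := hx
        obtain rfl := hv y (h _ he y (by simp)) (hM.1 he)
        exact hmem he
    · rintro (⟨hM, h⟩ | ⟨N, ⟨hN, h⟩, rfl⟩)
      · exact ⟨hM, fun e he x hx ↦ Finset.mem_of_mem_erase (h e he x hx)⟩
      · have hdis : ∀ e ∈ N, ∀ x, x ∈ e → x ∈ s(v, u) → False := by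
          intro e he x hx hx'
          have := h e he x hx
          simp only [Finset.mem_erase] at this
          rcases Sym2.mem_iff.1 hx' with rfl | rfl <;> simp_all
        refine ⟨⟨Set.insert_subset hvu hN.1, ?_⟩, ?_⟩
        · rintro e (rfl | he) f (rfl | hf) hne x ⟨hx, hx'⟩
          · exact hne rfl
          · exact hdis f hf x hx' hx
          · exact hdis e he x hx hx'
          · exact hN.2 e he f hf hne x ⟨hx, hx'⟩
        · rintro e (rfl | he) x hx
          · rcases Sym2.mem_iff.1 hx with rfl | rfl <;> assumption
          · exact Finset.mem_of_mem_erase (Finset.mem_of_mem_erase (h e he x hx))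
  rw [hunion, Set.ncard_union_eq, hinj.ncard_image]
  rw [Set.disjoint_left]
  rintro _ hM ⟨N, -, rfl⟩
  simpa using hM.2 _ (Set.mem_insert _ _) v (by simp)

theorem ncard_matchingsIn_le (hF : F.IsAcyclic) (S : Finset V) :
    (matchingsIn F S).ncard ≤ Nat.fib (S.card + 1) := by
  induction h : S.card using Nat.strong_induction_on generalizing S with
  | _ k ih =>
    subst h
    rcases S.eq_empty_or_nonempty with rfl | hS
    · simp [matchingsIn_empty]
    obtain ⟨v, hvS, hv⟩ := exists_mem_subsingleton_neighbors_of_isAcyclic hF hS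
    have hc := Finset.card_erase_add_one hvS
    have h₁ := ih _ (by omega) (S.erase v) rfl
    by_cases hu : ∃ u ∈ S, F.Adj v u
    · obtain ⟨u, huS, hvu⟩ := hu
      have hc' := Finset.card_erase_add_one (Finset.mem_erase.2 ⟨hvu.ne', huS⟩)
      have h₂ := ih _ (by omega) ((S.erase v).erase u) rfl
      rw [ncard_matchingsIn_leaf hvS huS hvu fun w hw hvw ↦ hv w hw u huS hvw hvu, ← hc, ← hc',
        Nat.fib_add_two]
      rw [← hc'] at h₁
      omega
    · push Not at hu
      rw [matchingsIn_erase_of_isolated hu]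
      exact h₁.trans (Nat.fib_mono (by omega))

theorem exists_isChain_of_ncard_matchingsIn_eq (hF : F.IsAcyclic) (S : Finset V)
    (hS : (matchingsIn F S).ncard = Nat.fib (S.card + 1)) :
    ∃ l : List V, l.Nodup ∧ l.toFinset = S ∧ l.IsChain F.Adj := by
  induction h : S.card using Nat.strong_induction_on generalizing S with
  | _ k ih =>
    subst h
    rcases S.eq_empty_or_nonempty with rfl | hne
    · exact ⟨[], by simp⟩
    obtain ⟨v, hvS, hv⟩ := exists_mem_subsingleton_neighbors_of_isAcyclic hF hne
    have hc := Finset.card_erase_add_one hvS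
    have h₁ := ncard_matchingsIn_le hF (S.erase v)
    by_cases hu : ∃ u ∈ S, F.Adj v u
    · obtain ⟨u, huS, hvu⟩ := hu
      have hc' := Finset.card_erase_add_one (Finset.mem_erase.2 ⟨hvu.ne', huS⟩)
      have h₂ := ncard_matchingsIn_le hF ((S.erase v).erase u)
      have hS' := hS
      rw [ncard_matchingsIn_leaf hvS huS hvu fun w hw hvw ↦ hv w hw u huS hvw hvu, ← hc, ← hc',
        Nat.fib_add_two] at hS'
      rw [← hc'] at h₁
      obtain ⟨l, hnd, hl, hch⟩ := ih _ (by omega) (S.erase v) (by rw [← hc']; omega) rfl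
      obtain ⟨l', -, hl', hch'⟩ := ih _ (by omega) ((S.erase v).erase u) (by omega) rfl
      have hml : ∀ x, x ∈ l ↔ x ≠ v ∧ x ∈ S := fun x ↦ by
        rw [← List.mem_toFinset, hl, Finset.mem_erase]
      have hml' : ∀ x, x ∈ l' ↔ x ≠ u ∧ x ≠ v ∧ x ∈ S := fun x ↦ by
        rw [← List.mem_toFinset, hl', Finset.mem_erase, Finset.mem_erase]
      have hvl : v ∉ l := fun h ↦ ((hml v).1 h).1 rfl
      have hins : insert v l.toFinset = S := by rw [hl, Finset.insert_erase hvS]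
      obtain ⟨l₁, l₂, rfl⟩ := List.append_of_mem ((hml u).2 ⟨hvu.ne', huS⟩)
      rcases List.eq_nil_or_concat l₁ with rfl | ⟨l₁, a, rfl⟩
      · refine ⟨v :: u :: l₂, by simpa using ⟨by simpa using hvl, by simpa using hnd⟩,
          by simpa using hins, ?_⟩
        simpa using ⟨hvu, hch⟩
      rcases l₂ with _ | ⟨b, l₂⟩
      · refine ⟨_ ++ [v], List.nodup_append.2 ⟨hnd, by simp, ?_⟩, ?_, ?_⟩
        · rintro x hx _ hy rfl
          exact hvl (by simp_all)
        · rw [← hins]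
          ext x
          simp
          tauto
        · rw [List.isChain_append]
          refine ⟨hch, by simp, ?_⟩
          simpa using hvu.symm
      · exfalso
        simp only [List.concat_eq_append, List.append_assoc, List.cons_append, List.nil_append] at *
        have hau : F.Adj a u := by
          have := (List.isChain_append_cons_cons.1 hch).2.1
          exact this
        have hub : F.Adj u b := by
          have := (List.isChain_append_cons_cons.1 hch).2.2
          exact (List.isChain_cons_cons.1 this).1
        have hab : a ≠ b := by
          rintro rfl
          simp [List.nodup_append] at hnd
        refine false_of_isChain_of_adj hF hch' (a := a) (b := b) (u := u) ?_ ?_ ?_ hab hau hub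
        · exact (hml' a).2 ⟨hau.ne, (hml a).1 (by simp)⟩
        · exact (hml' b).2 ⟨hub.ne', (hml b).1 (by simp)⟩
        · exact fun h ↦ ((hml' u).1 h).1 rfl
    · push Not at hu
      rw [matchingsIn_erase_of_isolated hu, ← hc] at hS
      have hle : (S.erase v).card = 0 := by
        by_contra h0
        have := Nat.fib_lt_fib_succ (n := (S.erase v).card + 1) (by omega)
        omega
      refine ⟨[v], by simp, ?_, by simp⟩
      rw [Finset.card_eq_zero] at hle
      rw [← Finset.insert_erase hvS, hle]
      simp

end

theorem mem_cutEdges {V : Type} {G : SimpleGraph V} {A : Set V} {u v : V} :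
    s(u, v) ∈ cutEdges G A ↔ G.Adj u v ∧ ¬(u ∈ A ↔ v ∈ A) := by
  constructor
  · rintro ⟨h, x, y, hxy, hx, hy⟩
    refine ⟨h, ?_⟩
    rcases Sym2.eq_iff.1 hxy with ⟨rfl, rfl⟩ | ⟨rfl, rfl⟩ <;> tauto
  · rintro ⟨h, hA⟩
    by_cases hu : u ∈ A
    · exact ⟨h, u, v, rfl, hu, by tauto⟩
    · exact ⟨h, v, u, Sym2.eq_swap, by tauto, hu⟩

theorem mem_iff_mem_of_reachable {V : Type} {F : SimpleGraph V} {A B : Set V}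
    (h : cutEdges F A = cutEdges F B) {u v : V} (huv : F.Reachable u v) :
    (u ∈ A ↔ v ∈ A) ↔ (u ∈ B ↔ v ∈ B) := by
  obtain ⟨p⟩ := huv
  induction p with
  | nil => simp
  | @cons x y z hxy _ ih =>
    have := Set.ext_iff.1 h s(x, y)
    rw [mem_cutEdges, mem_cutEdges] at this
    tauto

/-- The matchings of `G` of the form `E(A, Aᶜ)`, where `A` or `Aᶜ` may be empty. -/
def cutMatchings {V : Type} (G : SimpleGraph V) : Set (Set (Sym2 V)) :=
  {M | IsMatchingSet G M ∧ ∃ A : Set V, M = cutEdges G A}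

theorem cutEdges_inter_edgeSet {V : Type} {F G : SimpleGraph V} (hFG : F ≤ G) (A : Set V) :
    cutEdges G A ∩ F.edgeSet = cutEdges F A := by
  ext e
  induction e with
  | _ x y =>
    have := @hFG x y
    simp only [Set.mem_inter_iff, mem_cutEdges, SimpleGraph.mem_edgeSet]
    tauto

theorem injOn_inter_edgeSet_cutMatchings {V : Type} {F G : SimpleGraph V} (hFG : F ≤ G)
    (hr : F.Reachable = G.Reachable) : Set.InjOn (· ∩ F.edgeSet) (cutMatchings G) := by
  rintro _ ⟨-, A, rfl⟩ _ ⟨-, B, rfl⟩ h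
  simp only [cutEdges_inter_edgeSet hFG] at h
  ext e
  induction e with
  | _ x y =>
    simp only [mem_cutEdges, and_congr_right_iff]
    intro hxy
    rw [mem_iff_mem_of_reachable h (by rw [hr]; exact hxy.reachable)]

theorem image_inter_edgeSet_cutMatchings_subset {V : Type} [Fintype V] {F G : SimpleGraph V} :
    (· ∩ F.edgeSet) '' cutMatchings G ⊆ matchingsIn F Finset.univ := by
  rintro _ ⟨M, ⟨hM, -⟩, rfl⟩
  refine ⟨⟨Set.inter_subset_right, ?_⟩, by simp⟩
  exact fun e he f hf ↦ hM.2 e he.1 f hf.1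

theorem ncard_cutMatchings_le {V : Type} [Fintype V] {F G : SimpleGraph V} (hFG : F ≤ G)
    (hr : F.Reachable = G.Reachable) :
    (cutMatchings G).ncard ≤ (matchingsIn F Finset.univ).ncard := by
  rw [← (injOn_inter_edgeSet_cutMatchings hFG hr).ncard_image]
  exact Set.ncard_le_ncard image_inter_edgeSet_cutMatchings_subset

theorem setOf_isMatchingCut_of_connected {V : Type} {G : SimpleGraph V} (hG : G.Connected) :
    {M | IsMatchingCut G M} = cutMatchings G \ {∅} := by
  ext M
  constructor
  · rintro ⟨hM, A, ⟨a, ha⟩, ⟨b, hb⟩, rfl⟩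
    refine ⟨⟨hM, A, rfl⟩, fun h ↦ hb ?_⟩
    have h' : cutEdges G A = cutEdges G Set.univ := by
      rw [Set.mem_singleton_iff.1 h, eq_comm, Set.eq_empty_iff_forall_notMem]
      rintro e ⟨-, u, v, -, -, hv⟩
      exact hv trivial
    have := mem_iff_mem_of_reachable h' (hG.preconnected a b)
    simp only [Set.mem_univ] at this
    tauto
  · rintro ⟨⟨hM, A, rfl⟩, hne⟩
    refine ⟨hM, A, ?_, ?_, rfl⟩ <;>
    · obtain ⟨e, -, u, v, -, hu, hv⟩ := Set.nonempty_iff_ne_empty.2 hne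
      exact ⟨_, by assumption⟩

theorem setOf_isMatchingCut_of_not_preconnected {V : Type} {G : SimpleGraph V}
    (hG : ¬ G.Preconnected) : {M | IsMatchingCut G M} = cutMatchings G := by
  ext M
  constructor
  · rintro ⟨hM, A, -, -, rfl⟩
    exact ⟨hM, A, rfl⟩
  · rintro ⟨hM, A, rfl⟩
    refine ⟨hM, ?_⟩
    by_cases hA : A.Nonempty ∧ Aᶜ.Nonempty
    · exact ⟨A, hA.1, hA.2, rfl⟩
    · simp only [SimpleGraph.Preconnected, not_forall] at hG
      obtain ⟨a, b, hab⟩ := hG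
      refine ⟨{x | G.Reachable a x}, ⟨a, by simp⟩, ⟨b, hab⟩, ?_⟩
      ext e
      induction e with
      | _ x y =>
        simp only [mem_cutEdges, and_congr_right_iff, not_iff_not]
        intro hxy
        have h₁ : x ∈ A ↔ y ∈ A := by
          rw [not_and_or, Set.not_nonempty_iff_eq_empty, Set.not_nonempty_iff_eq_empty,
            Set.compl_empty_iff] at hA
          rcases hA with rfl | rfl <;> simp
        refine iff_of_true h₁ ⟨fun h ↦ ?_, fun h ↦ ?_⟩
        · exact SimpleGraph.Reachable.trans h hxy.reachable
        · exact SimpleGraph.Reachable.trans h hxy.symm.reachable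

theorem ncard_matchingsIn_univ_le_mul {V : Type} [Fintype V] {F : SimpleGraph V}
    {S T : Finset V} (h : ∀ x y, F.Adj x y → (x ∈ S ∧ y ∈ S) ∨ (x ∈ T ∧ y ∈ T)) :
    (matchingsIn F Finset.univ).ncard ≤ (matchingsIn F S).ncard * (matchingsIn F T).ncard := by
  rw [← Set.ncard_prod]
  have hsub : matchingsIn F Finset.univ ⊆
      (fun p ↦ p.1 ∪ p.2) '' (matchingsIn F S ×ˢ matchingsIn F T) := by
    rintro M ⟨hM, -⟩
    refine ⟨({e ∈ M | ∀ x ∈ e, x ∈ S}, {e ∈ M | ∀ x ∈ e, x ∈ T}),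
      ⟨⟨hM.mono (Set.sep_subset _ _), fun e he ↦ he.2⟩,
        ⟨hM.mono (Set.sep_subset _ _), fun e he ↦ he.2⟩⟩, ?_⟩
    ext e
    induction e with
    | _ x y =>
      have h₁ : s(x, y) ∈ M → F.Adj x y := fun he ↦ hM.1 he
      have h₂ := h x y
      simp only [Set.mem_union, Set.mem_ofPred_eq, Sym2.mem_iff, forall_eq_or_imp, forall_eq]
      tauto
  exact (Set.ncard_le_ncard hsub).trans Set.ncard_image_le

theorem ncard_matchingsIn_add_two_le_of_not_preconnected {V : Type} [Fintype V]
    (hV : 5 ≤ Fintype.card V) {F : SimpleGraph V} (hF : F.IsAcyclic) (hc : ¬ F.Preconnected) :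
    (matchingsIn F Finset.univ).ncard + 2 ≤ Nat.fib (Fintype.card V + 1) := by
  classical
  simp only [SimpleGraph.Preconnected, not_forall] at hc
  obtain ⟨a, b, hab⟩ := hc
  set S : Finset V := {x | F.Reachable a x} with hS
  have hle : (matchingsIn F Finset.univ).ncard ≤
      (matchingsIn F S).ncard * (matchingsIn F Sᶜ).ncard := by
    refine ncard_matchingsIn_univ_le_mul fun x y hxy ↦ ?_
    simp only [hS, Finset.mem_compl, Finset.mem_filter, Finset.mem_univ, true_and]
    have h₁ : F.Reachable a x → F.Reachable a y := fun h ↦ h.trans hxy.reachable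
    have h₂ : F.Reachable a y → F.Reachable a x := fun h ↦ h.trans hxy.symm.reachable
    tauto
  have hcard := S.card_add_card_compl
  have hS0 : 0 < S.card := Finset.card_pos.2 ⟨a, by simp [hS]⟩
  have hT0 : 0 < Sᶜ.card := Finset.card_pos.2 ⟨b, by simp [hS, hab]⟩
  have hmul := Nat.mul_le_mul (ncard_matchingsIn_le hF S) (ncard_matchingsIn_le hF Sᶜ)
  have hfib : 2 ≤ Nat.fib S.card * Nat.fib Sᶜ.card := by
    have h₁ := Nat.fib_pos.2 hS0
    have h₂ := Nat.fib_pos.2 hT0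
    rcases (by omega : 3 ≤ S.card ∨ 3 ≤ Sᶜ.card) with h | h
    · have := Nat.fib_mono h
      rw [(by rfl : Nat.fib 3 = 2)] at this
      nlinarith
    · have := Nat.fib_mono h
      rw [(by rfl : Nat.fib 3 = 2)] at this
      nlinarith
  rw [← hcard, Nat.fib_add]
  omega

/-- If every matching of `F` extends to a matching cut of `G`, then `G` has no edge joining two
non-consecutive vertices of a path of `F`. -/
theorem consecutive_of_adj {V : Type} {F G : SimpleGraph V} (hFG : F ≤ G)
    (hext : ∀ M, IsMatchingSet F M → ∃ N ∈ cutMatchings G, N ∩ F.edgeSet = M)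
    {l : List V} (hnd : l.Nodup) (hl : l.IsChain F.Adj) {i j : ℕ} (hij : i < j)
    (hj : j < l.length) (hadj : G.Adj l[i] l[j]) : i + 1 = j := by
  rw [List.isChain_iff_getElem] at hl
  by_contra hne
  have hM : IsMatchingSet F {s(l[i], l[i + 1])} :=
    ⟨by simpa using hl i (by omega), by rintro _ rfl _ rfl h; exact absurd rfl h⟩
  obtain ⟨_, ⟨hN, A, rfl⟩, hNM⟩ := hext _ hM
  have h₀ : s(l[i], l[i + 1]) ∈ cutEdges G A :=
    Set.inter_subset_left (hNM ▸ Set.mem_singleton _)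
  have hside : ∀ k (hk : k < l.length), i + 1 ≤ k → (l[k] ∈ A ↔ l[i + 1] ∈ A) := by
    intro k hk hik
    induction k, hik using Nat.le_induction with
    | base => rfl
    | succ k hik ih =>
      rw [← ih (by omega)]
      by_contra hc
      have hF := hl k hk
      have : s(l[k], l[k + 1]) ∈ cutEdges G A ∩ F.edgeSet :=
        ⟨mem_cutEdges.2 ⟨hFG hF, fun h ↦ hc h.symm⟩, hF⟩
      rw [hNM] at this
      have hmem : l[i] ∈ s(l[k], l[k + 1]) := Set.mem_singleton_iff.1 this ▸ (by simp)
      simp only [Sym2.mem_iff, hnd.getElem_inj_iff] at hmem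
      omega
  have h₁ : s(l[i], l[j]) ∈ cutEdges G A := by
    have := mem_cutEdges.1 h₀
    refine mem_cutEdges.2 ⟨hadj, ?_⟩
    rw [hside j hj (by omega)]
    exact this.2
  refine hN.2 _ h₀ _ h₁ ?_ l[i] (by simp)
  intro h
  have hmem : l[j] ∈ s(l[i], l[i + 1]) := h ▸ (by simp)
  simp only [Sym2.mem_iff, hnd.getElem_inj_iff] at hmem
  omega

theorem nonempty_iso_pathGraph_of_ncard_cutMatchings {V : Type} [Fintype V] {G : SimpleGraph V}
    (h : (cutMatchings G).ncard = Nat.fib (Fintype.card V + 1)) :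
    Nonempty (G ≃g SimpleGraph.pathGraph (Fintype.card V)) := by
  classical
  obtain ⟨F, hFG, hF, hr⟩ := G.exists_isAcyclic_reachable_eq_le
  have h₁ := ncard_cutMatchings_le hFG hr
  have h₂ := ncard_matchingsIn_le hF Finset.univ
  rw [Finset.card_univ] at h₂
  obtain ⟨l, hnd, hl, hch⟩ := exists_isChain_of_ncard_matchingsIn_eq hF Finset.univ
    (by rw [Finset.card_univ]; omega)
  have himg : (· ∩ F.edgeSet) '' cutMatchings G = matchingsIn F Finset.univ := by
    refine Set.eq_of_subset_of_ncard_le image_inter_edgeSet_cutMatchings_subset ?_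
    rw [(injOn_inter_edgeSet_cutMatchings hFG hr).ncard_image]
    omega
  have hext : ∀ M, IsMatchingSet F M → ∃ N ∈ cutMatchings G, N ∩ F.edgeSet = M := by
    intro M hM
    have : M ∈ matchingsIn F Finset.univ := ⟨hM, by simp⟩
    rwa [← himg] at this
  have hlen : l.length = Fintype.card V := by
    rw [← Finset.card_univ, ← hl, List.toFinset_card_of_nodup hnd]
  rw [← hlen]
  refine ⟨SimpleGraph.Iso.symm ⟨hnd.getEquivOfForallMemList l fun x ↦ ?_, ?_⟩⟩
  · rw [← List.mem_toFinset, hl]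
    exact Finset.mem_univ x
  · rintro ⟨i, hi⟩ ⟨j, hj⟩
    simp only [List.Nodup.getEquivOfForallMemList_apply, List.get_eq_getElem,
      SimpleGraph.pathGraph_adj]
    constructor
    · intro hadj
      rcases lt_trichotomy i j with hij | rfl | hij
      · exact .inl (consecutive_of_adj hFG hext hnd hch hij hj hadj)
      · exact absurd rfl hadj.ne
      · exact .inr (consecutive_of_adj hFG hext hnd hch hij hi hadj.symm)
    · rw [List.isChain_iff_getElem] at hch
      rintro (rfl | rfl)
      · exact hFG (hch i hj)
      · exact (hFG (hch j hi)).symm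

section

variable {V : Type} {n : ℕ} {G : SimpleGraph V}

theorem adj_iff_of_iso_pathGraph (e : G ≃g SimpleGraph.pathGraph n) (u v : V) :
    G.Adj u v ↔ (e u : ℕ) + 1 = e v ∨ (e v : ℕ) + 1 = e u := by
  rw [← SimpleGraph.pathGraph_adj, e.map_adj_iff]

theorem ncard_matchingsIn_initial_segment [Fintype V] (e : G ≃g SimpleGraph.pathGraph n)
    (k : ℕ) (hk : k ≤ n) :
    (matchingsIn G ({v | (e v : ℕ) < k} : Finset V)).ncard = Nat.fib (k + 1) := by
  classical
  induction k using Nat.strong_induction_on with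
  | _ k ih =>
  have herase : ∀ k, (hk : k < n) → ({v | (e v : ℕ) < k + 1} : Finset V).erase (e.symm ⟨k, hk⟩) =
      ({v | (e v : ℕ) < k} : Finset V) := by
    intro k hk
    ext v
    have : v = e.symm ⟨k, hk⟩ ↔ (e v : ℕ) = k := by
      rw [← e.injective.eq_iff, e.apply_symm_apply, Fin.ext_iff]
    simp only [Finset.mem_erase, Finset.mem_filter, Finset.mem_univ, true_and, ne_eq, this]
    omega
  match k with
  | 0 =>
    have : ({v | (e v : ℕ) < 0} : Finset V) = ∅ := by simp
    rw [this, matchingsIn_empty]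
    simp
  | 1 =>
    rw [matchingsIn_erase_of_isolated (v := e.symm ⟨0, hk⟩), herase 0 hk,
      ih 0 (by omega) (by omega)]
    · rfl
    · intro w hw
      simp only [Finset.mem_filter, Finset.mem_univ, true_and] at hw
      rw [adj_iff_of_iso_pathGraph e, e.apply_symm_apply]
      simp only
      omega
  | k + 2 =>
    rw [ncard_matchingsIn_leaf (v := e.symm ⟨k + 1, hk⟩) (u := e.symm ⟨k, by omega⟩),
      herase (k + 1) hk, herase k (by omega), ih _ (by omega) (by omega),
      ih _ (by omega) (by omega), Nat.fib_add_two (n := k + 1), add_comm]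
    · simp
    · simp
    · simp [adj_iff_of_iso_pathGraph e]
    · intro w hw
      rw [← e.injective.eq_iff, adj_iff_of_iso_pathGraph e, e.apply_symm_apply,
        e.apply_symm_apply, Fin.ext_iff]
      simp only [Finset.mem_filter, Finset.mem_univ, true_and] at hw
      simp only
      omega

theorem exists_eq_cutEdges_of_iso_pathGraph (e : G ≃g SimpleGraph.pathGraph n)
    {M : Set (Sym2 V)} (hM : M ⊆ G.edgeSet) :
    ∃ A, M = cutEdges G A := by
  classical
  let p : ℕ → Prop := Nat.rec False fun k q ↦
    ¬(q ↔ ∃ u v, (e u : ℕ) = k ∧ (e v : ℕ) = k + 1 ∧ s(u, v) ∈ M)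
  have hp : ∀ u v, (e u : ℕ) + 1 = e v → (s(u, v) ∈ M ↔ ¬(p (e u) ↔ p (e v))) := by
    intro u v huv
    have hstep : p (e v) ↔ ¬(p (e u) ↔ s(u, v) ∈ M) := by
      have : p ((e u : ℕ) + 1) ↔
          ¬(p (e u) ↔ ∃ x y, (e x : ℕ) = e u ∧ (e y : ℕ) = e u + 1 ∧ s(x, y) ∈ M) := Iff.rfl
      rw [huv] at this
      rw [this, not_iff_not]
      refine iff_congr Iff.rfl ⟨?_, fun h ↦ ⟨u, v, rfl, rfl, h⟩⟩
      rintro ⟨x, y, hx, hy, h⟩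
      rwa [e.injective (Fin.ext hx), e.injective (Fin.ext hy)] at h
    rw [hstep]
    generalize p (e u) = a
    generalize (s(u, v) ∈ M) = b
    by_cases a <;> by_cases b <;> simp_all
  refine ⟨{v | p (e v)}, ?_⟩
  ext f
  induction f with
  | _ x y =>
    rw [mem_cutEdges]
    have hadj : s(x, y) ∈ M → G.Adj x y := fun h ↦ hM h
    simp only [Set.mem_ofPred_eq]
    by_cases hxy : G.Adj x y
    · simp only [hxy, true_and]
      rcases (adj_iff_of_iso_pathGraph e x y).1 hxy with h | h
      · exact hp x y h
      · rw [Sym2.eq_swap, hp y x h, iff_comm (a := p (e y))]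
    · tauto

theorem ncard_cutMatchings_of_iso_pathGraph [Finite V] (e : G ≃g SimpleGraph.pathGraph n) :
    (cutMatchings G).ncard = Nat.fib (n + 1) := by
  have := Fintype.ofFinite V
  rw [← ncard_matchingsIn_initial_segment e n le_rfl]
  congr 1
  ext M
  constructor
  · rintro ⟨hM, -⟩
    exact ⟨hM, by simp⟩
  · rintro ⟨hM, -⟩
    exact ⟨hM, exists_eq_cutEdges_of_iso_pathGraph e hM.1⟩

end

theorem ncard_isMatchingCut_add_one {V : Type} [Finite V] {G : SimpleGraph V} (hG : G.Connected) :
    {M | IsMatchingCut G M}.ncard + 1 = (cutMatchings G).ncard := by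
  rw [setOf_isMatchingCut_of_connected hG]
  refine Set.ncard_sdiff_singleton_add_one ⟨isMatchingSet_empty G, ∅, ?_⟩
  rw [eq_comm, Set.eq_empty_iff_forall_notMem]
  rintro e ⟨-, u, v, -, hu, -⟩
  exact hu

/-- Let `n ≥ 5` and let `G` be a graph on `n` vertices.  Then `G` has exactly
`F(n + 1) - 1` matching cuts if and only if `G` is isomorphic to the path graph `P_n`. -/
theorem card_matchingCuts_eq_iff_path {V : Type} [Fintype V] (n : ℕ) (hn : 5 ≤ n)
    (G : SimpleGraph V) (hcard : Fintype.card V = n) :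
    Nat.card {M : Set (Sym2 V) // IsMatchingCut G M} = Nat.fib (n + 1) - 1 ↔
      Nonempty (G ≃g SimpleGraph.pathGraph n) := by
  have hfib : 0 < Nat.fib (n + 1) := Nat.fib_pos.2 (by omega)
  have hnat : Nat.card {M : Set (Sym2 V) // IsMatchingCut G M} = {M | IsMatchingCut G M}.ncard :=
    rfl
  rw [hnat]
  constructor
  · intro h
    have : Nonempty V := Fintype.card_pos_iff.1 (by omega)
    by_cases hG : G.Preconnected
    · have := ncard_isMatchingCut_add_one ⟨hG⟩
      subst hcard
      exact nonempty_iso_pathGraph_of_ncard_cutMatchings (by omega)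
    · exfalso
      obtain ⟨F, hFG, hF, hr⟩ := G.exists_isAcyclic_reachable_eq_le
      have h₁ := ncard_matchingsIn_add_two_le_of_not_preconnected (hcard ▸ hn) hF
        (by rwa [SimpleGraph.Preconnected, hr])
      have h₂ := ncard_cutMatchings_le hFG hr
      rw [setOf_isMatchingCut_of_not_preconnected hG] at h
      rw [hcard] at h₁
      omega
  · rintro ⟨e⟩
    obtain ⟨m, rfl⟩ : ∃ m, n = m + 1 := ⟨n - 1, by omega⟩
    have hG : G.Connected := e.connected_iff.2 (SimpleGraph.pathGraph_connected m)
    have h₁ := ncard_isMatchingCut_add_one hG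
    have h₂ := ncard_cutMatchings_of_iso_pathGraph e
    omega

end MatchingCutPaper
end

section
/- Let G be a graph whose connected components are G_1, …, G_k with k ≥ 2. Then the number of matching cuts of G equals the product over i = 1, …, k of (1 + the number of matching cuts of G_i). -/
namespace MatchingCutPaper

/-- The matchings of the form `E(A, Aᶜ)`, where `A` or its complement may be empty. -/
def IsWeakMatchingCut {V : Type} (G : SimpleGraph V) (M : Set (Sym2 V)) : Prop :=
  IsMatchingSet G M ∧ ∃ A : Set V, M = cutEdges G A

theorem mk_mem_cutEdges {V : Type} {G : SimpleGraph V} {A : Set V} {u v : V} :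
    s(u, v) ∈ cutEdges G A ↔ G.Adj u v ∧ (u ∈ A ↔ v ∉ A) := by
  simp only [cutEdges, Set.mem_ofPred_eq, SimpleGraph.mem_edgeSet, Sym2.eq_iff]
  refine and_congr_right fun _ => ⟨?_, fun h => ?_⟩
  · rintro ⟨x, y, ⟨rfl, rfl⟩ | ⟨rfl, rfl⟩, hx, hy⟩ <;> tauto
  · by_cases hu : u ∈ A
    · exact ⟨u, v, Or.inl ⟨rfl, rfl⟩, hu, h.1 hu⟩
    · exact ⟨v, u, Or.inr ⟨rfl, rfl⟩, by tauto, hu⟩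

theorem cutEdges_subset {V : Type} (G : SimpleGraph V) (A : Set V) :
    cutEdges G A ⊆ G.edgeSet := fun _ h => h.1

theorem isMatchingSet_cutEdges_iff {V : Type} {G : SimpleGraph V} {A : Set V} :
    IsMatchingSet G (cutEdges G A) ↔
      ∀ v u w, s(v, u) ∈ cutEdges G A → s(v, w) ∈ cutEdges G A → u = w := by
  constructor
  · intro h v u w hu hw
    by_contra hne
    exact h.2 _ hu _ hw (fun he => hne (Sym2.congr_right.1 he)) v
      ⟨Sym2.mem_mk_left _ _, Sym2.mem_mk_left _ _⟩
  · refine fun h => ⟨cutEdges_subset G A, ?_⟩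
    rintro e he f hf hne v ⟨hve, hvf⟩
    obtain ⟨u, rfl⟩ := hve
    obtain ⟨w, rfl⟩ := hvf
    exact hne (by rw [h v u w he hf])

theorem preimage_cutEdges {V : Type} (G : SimpleGraph V) (s A : Set V) :
    Sym2.map (Subtype.val : s → V) ⁻¹' cutEdges G A =
      cutEdges (G.induce s) (Subtype.val ⁻¹' A) := by
  ext e
  induction e with
  | _ u v => simp [mk_mem_cutEdges]

theorem isMatchingSet_cutEdges_iff_components {V : Type} {G : SimpleGraph V} {A : Set V} :
    IsMatchingSet G (cutEdges G A) ↔ ∀ c : G.ConnectedComponent,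
      IsMatchingSet (G.induce c.supp) (cutEdges (G.induce c.supp) (Subtype.val ⁻¹' A)) := by
  simp only [isMatchingSet_cutEdges_iff]
  simp only [← preimage_cutEdges, Set.mem_preimage, Sym2.map_mk]
  constructor
  · intro h c v u w hu hw
    exact Subtype.ext (h _ _ _ hu hw)
  · intro h v u w hu hw
    have huv : u ∈ (G.connectedComponentMk v).supp :=
      SimpleGraph.ConnectedComponent.sound (mk_mem_cutEdges.1 hu).1.symm.reachable
    have hwv : w ∈ (G.connectedComponentMk v).supp :=
      SimpleGraph.ConnectedComponent.sound (mk_mem_cutEdges.1 hw).1.symm.reachable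
    exact congrArg Subtype.val (h (G.connectedComponentMk v) ⟨v, rfl⟩ ⟨u, huv⟩ ⟨w, hwv⟩ hu hw)

theorem IsWeakMatchingCut.preimage {V : Type} {G : SimpleGraph V} {M : Set (Sym2 V)}
    (h : IsWeakMatchingCut G M) (c : G.ConnectedComponent) :
    IsWeakMatchingCut (G.induce c.supp) (Sym2.map Subtype.val ⁻¹' M) := by
  obtain ⟨hM, A, rfl⟩ := h
  rw [preimage_cutEdges]
  exact ⟨isMatchingSet_cutEdges_iff_components.1 hM c, _, rfl⟩

/-- Restriction of weak matching cuts to the connected components. -/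
def restrictToComponents {V : Type} (G : SimpleGraph V)
    (M : {M : Set (Sym2 V) // IsWeakMatchingCut G M}) (c : G.ConnectedComponent) :
    {M : Set (Sym2 c.supp) // IsWeakMatchingCut (G.induce c.supp) M} :=
  ⟨Sym2.map Subtype.val ⁻¹' M.1, M.2.preimage c⟩

theorem subset_of_preimage_eq {V : Type} {G : SimpleGraph V} {M N : Set (Sym2 V)}
    (hM : M ⊆ G.edgeSet)
    (h : ∀ c : G.ConnectedComponent,
      Sym2.map (Subtype.val : c.supp → V) ⁻¹' M = Sym2.map Subtype.val ⁻¹' N) : M ⊆ N := by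
  intro e he
  induction e with
  | _ u v =>
    have huv : v ∈ (G.connectedComponentMk u).supp :=
      SimpleGraph.ConnectedComponent.sound (SimpleGraph.Adj.reachable (hM he)).symm
    exact (Set.ext_iff.1 (h (G.connectedComponentMk u)) s(⟨u, rfl⟩, ⟨v, huv⟩)).1 he

theorem restrictToComponents_bijective {V : Type} (G : SimpleGraph V) :
    Function.Bijective (restrictToComponents G) := by
  constructor
  · intro M N h
    have h' (c : G.ConnectedComponent) := congrArg Subtype.val (congrFun h c)
    exact Subtype.ext (Set.Subset.antisymm (subset_of_preimage_eq M.2.1.1 h')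
      (subset_of_preimage_eq N.2.1.1 fun c => (h' c).symm))
  · intro f
    choose A hA using fun c => (f c).2.2
    let B : Set V := {v | (⟨v, rfl⟩ : (G.connectedComponentMk v).supp) ∈ A _}
    have hB (c : G.ConnectedComponent) : (Subtype.val : c.supp → V) ⁻¹' B = A c := by
      ext ⟨v, rfl⟩
      rfl
    have hM : IsMatchingSet G (cutEdges G B) :=
      isMatchingSet_cutEdges_iff_components.2 fun c => by
        rw [hB, ← hA]
        exact (f c).2.1
    refine ⟨⟨cutEdges G B, hM, B, rfl⟩, funext fun c => Subtype.ext ?_⟩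
    change Sym2.map Subtype.val ⁻¹' cutEdges G B = _
    rw [preimage_cutEdges, hB, ← hA]

theorem cutEdges_empty {V : Type} (G : SimpleGraph V) : cutEdges G ∅ = ∅ := by
  simp [cutEdges]

theorem cutEdges_univ {V : Type} (G : SimpleGraph V) : cutEdges G Set.univ = ∅ := by
  simp [cutEdges]

theorem cutEdges_supp {V : Type} (G : SimpleGraph V) (c : G.ConnectedComponent) :
    cutEdges G c.supp = ∅ := by
  refine Set.eq_empty_of_forall_notMem fun e => ?_
  induction e with
  | _ u v =>
    rw [mk_mem_cutEdges]
    rintro ⟨h, h'⟩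
    have := c.mem_supp_congr_adj h
    tauto

theorem isWeakMatchingCut_iff {V : Type} {G : SimpleGraph V} {M : Set (Sym2 V)} :
    IsWeakMatchingCut G M ↔ M = ∅ ∨ IsMatchingCut G M := by
  constructor
  · rintro ⟨hM, A, rfl⟩
    rcases A.eq_empty_or_nonempty with rfl | hA
    · exact Or.inl (cutEdges_empty G)
    rcases Aᶜ.eq_empty_or_nonempty with hA' | hA'
    · rw [Set.compl_empty_iff] at hA'
      exact Or.inl (hA' ▸ cutEdges_univ G)
    · exact Or.inr ⟨hM, A, hA, hA', rfl⟩
  · rintro (rfl | ⟨hM, A, -, -, rfl⟩)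
    · exact ⟨isMatchingSet_empty G, ∅, (cutEdges_empty G).symm⟩
    · exact ⟨hM, A, rfl⟩

theorem isMatchingCut_empty {V : Type} {G : SimpleGraph V} [Nontrivial G.ConnectedComponent] :
    IsMatchingCut G ∅ := by
  obtain ⟨c, d, hcd⟩ := exists_pair_ne G.ConnectedComponent
  obtain ⟨v, rfl⟩ := d.exists_rep
  exact ⟨isMatchingSet_empty G, c.supp, c.nonempty_supp, ⟨v, fun h => hcd h.symm⟩,
    (cutEdges_supp G c).symm⟩

theorem not_isMatchingCut_empty {V : Type} {G : SimpleGraph V} (hG : G.Preconnected) :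
    ¬ IsMatchingCut G ∅ := by
  rintro ⟨-, A, ⟨a, ha⟩, ⟨b, hb⟩, h⟩
  obtain ⟨p⟩ := hG a b
  obtain ⟨d, -, hd, hd'⟩ := p.exists_boundary_dart A ha hb
  have : s(d.fst, d.snd) ∈ cutEdges G A := mk_mem_cutEdges.2 ⟨d.adj, by tauto⟩
  rw [← h] at this
  exact this

theorem card_weakMatchingCuts {V : Type} [Finite V] {G : SimpleGraph V} (hG : G.Preconnected) :
    Nat.card {M : Set (Sym2 V) // IsWeakMatchingCut G M} =
      1 + Nat.card {M : Set (Sym2 V) // IsMatchingCut G M} := by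
  have h : {M | IsWeakMatchingCut G M} = insert ∅ {M | IsMatchingCut G M} :=
    Set.ext fun M => isWeakMatchingCut_iff
  change Set.ncard {M | IsWeakMatchingCut G M} = 1 + Set.ncard {M | IsMatchingCut G M}
  have h' : ∅ ∉ {M | IsMatchingCut G M} := not_isMatchingCut_empty hG
  rw [h, Set.ncard_insert_of_notMem h', add_comm]

/-- Let `G` be a graph with `k ≥ 2` connected components.  Then the number of matching
cuts of `G` equals the product, over all connected components `c`, of
`1 +` the number of matching cuts of the subgraph induced by `c`. -/
theorem card_matchingCuts_eq_prod_components {V : Type} [Fintype V] (G : SimpleGraph V)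
    (hk : 2 ≤ Nat.card G.ConnectedComponent) :
    Nat.card {M : Set (Sym2 V) // IsMatchingCut G M} =
      ∏ᶠ c : G.ConnectedComponent,
        (1 + Nat.card {M : Set (Sym2 ↥(c.supp)) // IsMatchingCut (G.induce c.supp) M}) := by
  have : Fintype G.ConnectedComponent := Fintype.ofFinite _
  have : Nontrivial G.ConnectedComponent := Finite.one_lt_card_iff_nontrivial.1 hk
  have h (M : Set (Sym2 V)) : IsMatchingCut G M ↔ IsWeakMatchingCut G M := by
    rw [isWeakMatchingCut_iff]
    exact ⟨Or.inr, fun h => h.elim (fun h => h ▸ isMatchingCut_empty) id⟩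
  rw [Nat.card_congr (Equiv.subtypeEquivRight h),
    Nat.card_eq_of_bijective _ (restrictToComponents_bijective G), Nat.card_pi,
    finprod_eq_prod_of_fintype]
  exact Finset.prod_congr rfl fun c _ => card_weakMatchingCuts c.connected_toSimpleGraph.preconnected

end MatchingCutPaper
end
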